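/- Let H = (V, E) be a rooted hypertree with host tree T rooted at x, and for e ∈ E set min(e) = min{dist_T(v, x) : v ∈ e}. Let ≻ be any total order on E such that for all e, e' ∈ E, min(e) < min(e') implies e ≻ e'. Then with respect to ≻, every potentially-type-2 subset of E is type-2 (so ≻ witnesses that the edge ideal I(H) is bridge-friendly). -/

import Mathlib

/-- The "lcm" of a collection of supports of squarefree monomials: the union. -/
def lcmU {α : Type*} [DecidableEq α] (σ : Finset (Finset α)) : Finset α := σ.sup id

/-- `m` is a bridge of `σ`: `m ∈ σ` and removing `m` does not change the lcm. -/
def IsBridge {α : Type*} [DecidableEq α] (σ : Finset (Finset α)) (m : Finset α) : Prop :=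
  m ∈ σ ∧ lcmU (σ.erase m) = lcmU σ

/-- `m` is a gap of `σ` (relative to the generating set `M`): `m ∈ M`, `m ∉ σ`,
and adding `m` does not change the lcm. -/
def IsGap {α : Type*} [DecidableEq α] (M : Set (Finset α)) (σ : Finset (Finset α))
    (m : Finset α) : Prop :=
  m ∈ M ∧ m ∉ σ ∧ lcmU (insert m σ) = lcmU σ

/-- `m` is a true gap of `σ` w.r.t. the total order encoded by `ord`
(`a` dominates `b` iff `ord b < ord a`). -/
def IsTrueGap {α : Type*} [DecidableEq α] (M : Set (Finset α)) (ord : Finset α → ℕ)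
    (σ : Finset (Finset α)) (m : Finset α) : Prop :=
  IsGap M σ m ∧ ∀ m', IsBridge (insert m σ) m' → ord m' < ord m → IsBridge σ m'

/-- `σ` is potentially-type-2: it has a bridge dominating no true gap of `σ`. -/
def PotType2 {α : Type*} [DecidableEq α] (M : Set (Finset α)) (ord : Finset α → ℕ)
    (σ : Finset (Finset α)) : Prop :=
  ∃ m, IsBridge σ m ∧ ∀ g, IsTrueGap M ord σ g → ¬ ord g < ord m

/-- `b` is the smallest bridge of `σ` w.r.t. the total order encoded by `ord`. -/
def IsSBridge {α : Type*} [DecidableEq α] (ord : Finset α → ℕ) (σ : Finset (Finset α))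
    (b : Finset α) : Prop :=
  IsBridge σ b ∧ ∀ b', IsBridge σ b' → ord b ≤ ord b'

/-- `σ` is type-2: it is potentially-type-2, and any other potentially-type-2 `σ'` with
`σ' \ {sbridge σ'} = σ \ {sbridge σ}` satisfies `sbridge σ' ≻ sbridge σ`. -/
def Type2 {α : Type*} [DecidableEq α] (M : Set (Finset α)) (ord : Finset α → ℕ)
    (σ : Finset (Finset α)) : Prop :=
  PotType2 M ord σ ∧ ∀ σ' : Finset (Finset α), ↑σ' ⊆ M → σ' ≠ σ → PotType2 M ord σ' →
    ∀ b b', IsSBridge ord σ b → IsSBridge ord σ' b' → σ'.erase b' = σ.erase b →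
      ord b < ord b'

/-- `M` (an antichain of supports of the minimal generators of a squarefree monomial
ideal) is bridge-friendly: there is a total order on `M` (encoded by an injection
`ord : Finset α → ℕ`, where `a ≻ b` iff `ord b < ord a`) for which every
potentially-type-2 subset of `M` is type-2. -/
def BridgeFriendly {α : Type*} [DecidableEq α] (M : Set (Finset α)) : Prop :=
  ∃ ord : Finset α → ℕ, Set.InjOn ord M ∧
    ∀ σ : Finset (Finset α), ↑σ ⊆ M → PotType2 M ord σ → Type2 M ord σ

/-- `T` is a host graph of the hypergraph with edge set `E`: for each edge `e ∈ E`, the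
induced subgraph of `T` on the vertices of `e` is connected. -/
def IsHostGraph {V : Type*} [DecidableEq V] (T : SimpleGraph V) (E : Set (Finset V)) : Prop :=
  ∀ e ∈ E, (SimpleGraph.induce (↑e : Set V) T).Connected

/-- The tree `T` together with the vertex `x` is a host tree of the hypergraph with edge
set `E` rooted at `x`: `T` is a tree host graph and the distances in `T` from `x` to the
vertices of any single edge are pairwise distinct. -/
def IsRootedHostTree {V : Type*} [DecidableEq V] (T : SimpleGraph V) (x : V)
    (E : Set (Finset V)) : Prop :=
  T.IsTree ∧ IsHostGraph T E ∧
    ∀ e ∈ E, ∀ v ∈ e, ∀ w ∈ e, v ≠ w → T.dist x v ≠ T.dist x w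

lemma mem_lcmU {α : Type*} [DecidableEq α] {σ : Finset (Finset α)} {v : α} :
    v ∈ lcmU σ ↔ ∃ e ∈ σ, v ∈ e := by
  simp [lcmU, Finset.mem_sup]

lemma isBridge_iff {α : Type*} [DecidableEq α] {σ : Finset (Finset α)} {m : Finset α} :
    IsBridge σ m ↔ m ∈ σ ∧ ∀ v ∈ m, ∃ e ∈ σ, e ≠ m ∧ v ∈ e := by
  refine and_congr_right fun hm => ⟨fun h v hv => ?_, fun h => ?_⟩
  · obtain ⟨e, he, hve⟩ := mem_lcmU.1 (h ▸ mem_lcmU.2 ⟨m, hm, hv⟩ : v ∈ lcmU (σ.erase m))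
    exact ⟨e, Finset.mem_of_mem_erase he, Finset.ne_of_mem_erase he, hve⟩
  · ext v
    simp only [mem_lcmU, Finset.mem_erase]
    constructor
    · rintro ⟨e, ⟨-, he⟩, hve⟩
      exact ⟨e, he, hve⟩
    · rintro ⟨e, he, hve⟩
      by_cases hem : e = m
      · obtain ⟨f, hf, hfm, hvf⟩ := h v (hem ▸ hve)
        exact ⟨f, ⟨hfm, hf⟩, hvf⟩
      · exact ⟨e, ⟨hem, he⟩, hve⟩

/-- In a tree, a vertex has at most one neighbour closer to the root. -/
lemma SimpleGraph.IsTree.eq_of_adj_of_dist {V : Type*} {T : SimpleGraph V} (hT : T.IsTree)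
    {x u p q : V} (hp : T.Adj p u) (hq : T.Adj q u) (hpd : T.dist x p + 1 = T.dist x u)
    (hqd : T.dist x q + 1 = T.dist x u) : p = q := by
  obtain ⟨w, hw⟩ := hT.connected.exists_walk_length_eq_dist x p
  obtain ⟨w', hw'⟩ := hT.connected.exists_walk_length_eq_dist x q
  have h1 : (w.concat hp).IsPath :=
    SimpleGraph.Walk.isPath_of_length_eq_dist _ (by simp [hw, hpd])
  have h2 : (w'.concat hq).IsPath :=
    SimpleGraph.Walk.isPath_of_length_eq_dist _ (by simp [hw', hqd])
  exact (SimpleGraph.Walk.concat_inj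
    (congrArg Subtype.val ((hT.isAcyclic.subsingleton_path _ _).elim ⟨_, h1⟩ ⟨_, h2⟩))).1

lemma IsRootedHostTree.exists_parent_mem {V : Type*} [DecidableEq V] {T : SimpleGraph V} {x : V}
    {E : Set (Finset V)} (h : IsRootedHostTree T x E) {e : Finset V} (he : e ∈ E) {u w : V}
    (hu : u ∈ e) (hw : w ∈ e) (hlt : T.dist x w < T.dist x u) :
    ∃ p ∈ e, T.Adj p u ∧ T.dist x p + 1 = T.dist x u := by
  obtain ⟨hT, hhost, hdist⟩ := h
  obtain ⟨walk⟩ := (hhost e he).preconnected ⟨u, hu⟩ ⟨w, hw⟩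
  obtain ⟨d, -, hd1, hd2⟩ := walk.exists_boundary_dart
    {a | T.dist x u ≤ T.dist x a.1} (by simp) (by simpa using hlt)
  obtain ⟨⟨⟨a, ha⟩, ⟨b, hb⟩⟩, hadj⟩ := d
  have hab : T.Adj a b := hadj
  simp only [Set.mem_ofPred_eq, not_le] at hd1 hd2
  have htri : T.dist x a ≤ T.dist x b + T.dist b a := hT.connected.dist_triangle
  rw [SimpleGraph.dist_eq_one_iff_adj.2 hab.symm] at htri
  have hau : a = u := by
    by_contra hne
    exact hdist e he a ha u hu hne (by omega)
  subst hau
  exact ⟨b, hb, hab.symm, by omega⟩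

/-- If an edge `f` starts no deeper than `e` and meets it in `u`, then `f` contains every vertex
of `e` lying no deeper than `u`. -/
lemma IsRootedHostTree.mem_of_dist_le {V : Type*} [DecidableEq V] {T : SimpleGraph V} {x : V}
    {E : Set (Finset V)} (h : IsRootedHostTree T x E) {e f : Finset V} (he : e ∈ E) (hf : f ∈ E)
    (hmin : sInf ((fun v => T.dist x v) '' ↑f) ≤ sInf ((fun v => T.dist x v) '' ↑e))
    {u v : V} (hue : u ∈ e) (huf : u ∈ f) (hv : v ∈ e) (hvu : T.dist x v ≤ T.dist x u) :
    v ∈ f := by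
  obtain ⟨n, hn⟩ : ∃ n, T.dist x u = n := ⟨_, rfl⟩
  induction n using Nat.strong_induction_on generalizing u with
  | _ n ih =>
    rcases hvu.lt_or_eq with hlt | heq
    · obtain ⟨w, hw, hwmin⟩ := Nat.sInf_mem
        (s := (fun v => T.dist x v) '' (f : Set V)) ⟨_, u, huf, rfl⟩
      have hev : sInf ((fun v => T.dist x v) '' (e : Set V)) ≤ T.dist x v :=
        Nat.sInf_le ⟨v, hv, rfl⟩
      dsimp only at hwmin
      obtain ⟨p, hpe, hpu, hpd⟩ := h.exists_parent_mem he hue hv hlt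
      obtain ⟨q, hqf, hqu, hqd⟩ := h.exists_parent_mem hf huf hw (by omega)
      obtain rfl := h.1.eq_of_adj_of_dist hpu hqu hpd hqd
      exact ih (T.dist x p) (by omega) hpe hqf (by omega) rfl
    · by_cases hne : v = u
      · exact hne ▸ huf
      · exact absurd heq (h.2.2 e he v hv u hue hne)

lemma IsRootedHostTree.not_lt_of_erase_sbridge_eq {V : Type*} [DecidableEq V]
    {T : SimpleGraph V} {x : V} {E : Set (Finset V)} (h : IsRootedHostTree T x E)
    {ord : Finset V → ℕ}
    (hord : ∀ e ∈ E, ∀ e' ∈ E,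
      sInf ((fun v => T.dist x v) '' ↑e) < sInf ((fun v => T.dist x v) '' ↑e') →
        ord e' < ord e)
    {σ σ' : Finset (Finset V)} (hσ : ↑σ ⊆ E) (hσ' : ↑σ' ⊆ E) (hpot : PotType2 E ord σ)
    {b b' : Finset V} (hb : IsSBridge ord σ b) (hb' : IsSBridge ord σ' b')
    (heq : σ'.erase b' = σ.erase b) : ¬ ord b' < ord b := by
  intro hlt
  have hmem : ∀ e, (e ≠ b' ∧ e ∈ σ') ↔ (e ≠ b ∧ e ∈ σ) := fun e => by
    rw [← Finset.mem_erase, ← Finset.mem_erase, heq]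
  have hne : b' ≠ b := fun hbb => by simp [hbb] at hlt
  have hb'σ : b' ∉ σ := fun hmb => ((hmem b').2 ⟨hne, hmb⟩).1 rfl
  have hgap : IsGap E σ b' := by
    refine ⟨hσ' hb'.1.1, hb'σ, ?_⟩
    have hins : b' ∈ insert b' σ := Finset.mem_insert_self _ _
    have hbr : IsBridge (insert b' σ) b' := isBridge_iff.2 ⟨hins, fun v hv => by
      obtain ⟨e, heσ, hne', hve⟩ := (isBridge_iff.1 hb'.1).2 v hv
      exact ⟨e, Finset.mem_insert_of_mem ((hmem e).1 ⟨hne', heσ⟩).2, hne', hve⟩⟩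
    rw [← hbr.2, Finset.erase_insert hb'σ]
  obtain ⟨m₀, hm₀, hm₀gap⟩ := hpot
  have hnot : ¬ IsTrueGap E ord σ b' := fun hg =>
    hm₀gap b' hg (hlt.trans_le (hb.2 m₀ hm₀))
  obtain ⟨m, hm, hmb', hmσ⟩ : ∃ m, IsBridge (insert b' σ) m ∧ ord m < ord b' ∧
      ¬ IsBridge σ m := by
    by_contra! hcon
    exact hnot ⟨hgap, hcon⟩
  have hmσ' : ¬ IsBridge σ' m := fun hbr => (hb'.2 m hbr).not_gt hmb'
  have hmneb' : m ≠ b' := fun hmb => by simp [hmb] at hmb'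
  have hmneb : m ≠ b := fun hmb => by rw [hmb] at hmb'; omega
  obtain ⟨hmins, hmcov⟩ := isBridge_iff.1 hm
  have hmmem : m ∈ σ := Finset.mem_of_mem_insert_of_ne hmins hmneb'
  have hmmem' : m ∈ σ' := ((hmem m).2 ⟨hmneb, hmmem⟩).2
  obtain ⟨u, hum, hu⟩ : ∃ u ∈ m, ∀ e ∈ σ, e ≠ m → u ∉ e := by
    by_contra! hcon
    exact hmσ (isBridge_iff.2 ⟨hmmem, hcon⟩)
  obtain ⟨v, hvm, hv⟩ : ∃ v ∈ m, ∀ e ∈ σ', e ≠ m → v ∉ e := by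
    by_contra! hcon
    exact hmσ' (isBridge_iff.2 ⟨hmmem', hcon⟩)
  have hub' : u ∈ b' := by
    obtain ⟨e, heσ, hem, hue⟩ := hmcov u hum
    rcases Finset.mem_insert.1 heσ with rfl | heσ
    · exact hue
    · exact absurd hue (hu e heσ hem)
  have hvb : v ∈ b := by
    obtain ⟨e, heσ, hem, hve⟩ := hmcov v hvm
    by_cases heb' : e = b'
    · exact absurd hve (hv e (heb' ▸ hb'.1.1) hem)
    by_cases heb : e = b
    · exact heb ▸ hve
    exact absurd hve
      (hv e ((hmem e).2 ⟨heb, Finset.mem_of_mem_insert_of_ne heσ heb'⟩).2 hem)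
  have hmE : m ∈ E := hσ hmmem
  have hbE : b ∈ E := hσ hb.1.1
  have hb'E : b' ∈ E := hσ' hb'.1.1
  rcases le_total (T.dist x v) (T.dist x u) with hle | hle
  · refine hv b' hb'.1.1 hmneb'.symm (h.mem_of_dist_le hmE hb'E ?_ hum hub' hvm hle)
    by_contra! hmin
    exact (hord m hmE b' hb'E hmin).not_gt hmb'
  · refine hu b hb.1.1 hmneb.symm (h.mem_of_dist_le hmE hbE ?_ hvm hvb hum hle)
    by_contra! hmin
    exact (hord m hmE b hbE hmin).not_gt (hmb'.trans hlt)

/-- Let `E` be the edge set of a rooted hypertree with host tree `T` rooted at `x`, and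
for `e ∈ E` let `min(e)` denote the minimum distance in `T` from `x` to a vertex of
`e`.  If `≻` is a total order on `E` (encoded by an injection `ord`, with `e ≻ e'` iff
`ord e' < ord e`) such that `min(e) < min(e')` implies `e ≻ e'`, then every
potentially-type-2 subset of `E` is type-2 with respect to `≻`; hence `≻` witnesses
that the edge ideal `I(H)` is bridge-friendly. -/
theorem rootedHypertree_order_witness {V : Type*} [Fintype V] [DecidableEq V]
    (E : Set (Finset V))
    (hne : ∀ e ∈ E, e.Nonempty)
    (hanti : ∀ e ∈ E, ∀ f ∈ E, e ⊆ f → e = f)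
    (T : SimpleGraph V) (x : V) (hhost : IsRootedHostTree T x E)
    (ord : Finset V → ℕ) (hinj : Set.InjOn ord E)
    (hord : ∀ e ∈ E, ∀ e' ∈ E,
      sInf ((fun v => T.dist x v) '' ↑e) < sInf ((fun v => T.dist x v) '' ↑e') →
        ord e' < ord e) :
    ∀ σ : Finset (Finset V), ↑σ ⊆ E → PotType2 E ord σ → Type2 E ord σ := by
  intro σ hσ hpot
  refine ⟨hpot, fun σ' hσ' hσne hpot' b b' hb hb' heq => ?_⟩
  rcases lt_trichotomy (ord b) (ord b') with hlt | hbb | hlt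
  · exact hlt
  · have hbb' : b = b' := hinj (hσ hb.1.1) (hσ' hb'.1.1) hbb
    refine absurd ?_ hσne
    rw [← Finset.insert_erase hb'.1.1, heq, ← hbb', Finset.insert_erase hb.1.1]
  · exact absurd hlt (hhost.not_lt_of_erase_sbridge_eq hord hσ hσ' hpot hb hb' heq)
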